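/- For every ξ ≤ 0, lim_{n→∞} ∏_{k=0}^{n−1} ( 1 − x_{n,k}(ξ) ) = e^{ξ}, and the convergence is uniform for ξ in compact subsets of (−∞, 0]. (This product equals the probability P_n[R₀ n δ (|z|_n − R₀) log 4 ≤ ξ] for the rescaled spectral radius of the hard edge ensemble with radially symmetric potential Q.) -/

import Mathlib

open MeasureTheory Filter Finset

/-- `V_{n,k}(r) = Q(r) − (2 − (2k+1)/n) log r`. -/
noncomputable def Vnk (Q : ℝ → ℝ) (n k : ℕ) (r : ℝ) : ℝ :=
  Q r - (2 - (2 * (k : ℝ) + 1) / n) * Real.log r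

/-- The rescaled radius `x_n(ξ) = R₀ + ξ/(n R₀ δ log 4)`. -/
noncomputable def xn (R₀ δ : ℝ) (n : ℕ) (ξ : ℝ) : ℝ :=
  R₀ + ξ / (n * R₀ * δ * Real.log 4)

/-- The gap-probability factor
`x_{n,k}(ξ) = (∫_{x_n(ξ)}^{R₀} e^{−n V_{n,k}(r)} dr) / (∫_{r₀}^{R₀} e^{−n V_{n,k}(r)} dr)`. -/
noncomputable def xnk (Q : ℝ → ℝ) (r₀ R₀ δ : ℝ) (n k : ℕ) (ξ : ℝ) : ℝ :=
  (∫ r in (xn R₀ δ n ξ)..R₀, Real.exp (-(n : ℝ) * Vnk Q n k r)) /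
  (∫ r in r₀..R₀, Real.exp (-(n : ℝ) * Vnk Q n k r))

open scoped Topology

/-- The exponentially tilted integral `∫₀ˢ e^{−N p(t) + 2κt} dt`. -/
noncomputable def tiltedIntegral (p : ℝ → ℝ) (N κ s : ℝ) : ℝ :=
  ∫ t in (0 : ℝ)..s, Real.exp (-N * p t + 2 * κ * t)

theorem exists_quadratic_bounds {p : ℝ → ℝ} {T b : ℝ} (hp : Continuous p) (hT : 0 < T)
    (hp0 : p 0 = 0) (hpos : ∀ t, 0 < t → t ≤ T → 0 < p t) (hb : 0 < b)
    (hlim : Tendsto (fun t => p t / t ^ 2) (𝓝[>] 0) (𝓝 b)) :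
    ∃ a > 0, ∃ A > 0, ∀ t, 0 ≤ t → t ≤ T → a * t ^ 2 ≤ p t ∧ p t ≤ A * t ^ 2 := by
  classical
  set q : ℝ → ℝ := Function.update (fun t => p t / t ^ 2) 0 b with hq
  have hq_ne : ∀ t, t ≠ 0 → q t = p t / t ^ 2 := fun t ht => by simp [hq, ht]
  have hq_zero : q 0 = b := by simp [hq]
  have hcont : ContinuousOn q (Set.Icc 0 T) := by
    intro t ht
    rcases eq_or_lt_of_le ht.1 with rfl | h
    · rw [hq, continuousWithinAt_update_same]
      refine hlim.mono_left (nhdsWithin_mono _ ?_)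
      rintro x ⟨⟨hx, -⟩, hne⟩
      exact lt_of_le_of_ne hx (Ne.symm hne)
    · refine ContinuousAt.continuousWithinAt ?_
      have : ContinuousAt (fun t => p t / t ^ 2) t :=
        hp.continuousAt.div (by fun_prop) (by positivity)
      refine this.congr ?_
      filter_upwards [isOpen_ne.mem_nhds h.ne'] with x hx
      exact (hq_ne x hx).symm
  have hne : (Set.Icc 0 T).Nonempty := Set.nonempty_Icc.2 hT.le
  have hqpos : ∀ t ∈ Set.Icc 0 T, 0 < q t := by
    intro t ht
    rcases eq_or_lt_of_le ht.1 with rfl | h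
    · rwa [hq_zero]
    · rw [hq_ne t h.ne']
      exact div_pos (hpos t h ht.2) (by positivity)
  obtain ⟨x, hx, hmin⟩ := isCompact_Icc.exists_isMinOn hne hcont
  obtain ⟨y, hy, hmax⟩ := isCompact_Icc.exists_isMaxOn hne hcont
  refine ⟨q x, hqpos x hx, q y, hqpos y hy, fun t h0 h1 => ?_⟩
  have hpq : p t = q t * t ^ 2 := by
    rcases eq_or_lt_of_le h0 with rfl | h
    · simp [hp0]
    · rw [hq_ne t h.ne']
      field_simp
  rw [hpq]
  exact ⟨mul_le_mul_of_nonneg_right (hmin ⟨h0, h1⟩) (sq_nonneg t),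
    mul_le_mul_of_nonneg_right (hmax ⟨h0, h1⟩) (sq_nonneg t)⟩

theorem continuous_tilted_integrand {p : ℝ → ℝ} (hp : Continuous p) (N κ : ℝ) :
    Continuous fun t => Real.exp (-N * p t + 2 * κ * t) := by
  fun_prop

theorem intervalIntegrable_tilted_integrand {p : ℝ → ℝ} (hp : Continuous p) (N κ u v : ℝ) :
    IntervalIntegrable (fun t => Real.exp (-N * p t + 2 * κ * t)) volume u v :=
  (continuous_tilted_integrand hp N κ).intervalIntegrable u v

theorem continuous_tiltedIntegral {p : ℝ → ℝ} (hp : Continuous p) (N s : ℝ) :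
    Continuous fun κ => tiltedIntegral p N κ s := by
  refine intervalIntegral.continuous_parametric_intervalIntegral_of_continuous' ?_ 0 s
  simp only [Function.uncurry_def]
  fun_prop

theorem tiltedIntegral_pos {p : ℝ → ℝ} (hp : Continuous p) (N κ : ℝ) {s : ℝ} (hs : 0 < s) :
    0 < tiltedIntegral p N κ s :=
  intervalIntegral.intervalIntegral_pos_of_pos (intervalIntegrable_tilted_integrand hp N κ 0 s)
    (fun _ => Real.exp_pos _) hs

theorem tiltedIntegral_nonneg (p : ℝ → ℝ) (N κ : ℝ) {s : ℝ} (hs : 0 ≤ s) :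
    0 ≤ tiltedIntegral p N κ s :=
  intervalIntegral.integral_nonneg hs fun _ _ => (Real.exp_pos _).le

theorem tiltedIntegral_add {p : ℝ → ℝ} (hp : Continuous p) (N κ w T : ℝ) :
    tiltedIntegral p N κ w + ∫ t in w..T, Real.exp (-N * p t + 2 * κ * t) =
      tiltedIntegral p N κ T :=
  intervalIntegral.integral_add_adjacent_intervals (intervalIntegrable_tilted_integrand hp N κ _ _)
    (intervalIntegrable_tilted_integrand hp N κ _ _)

/-- Tilting moves mass away from `0`, so the relative mass of `[0, w]` decreases with the tilt. -/
theorem antitone_tiltedIntegral_div {p : ℝ → ℝ} (hp : Continuous p) (N : ℝ) {w T : ℝ}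
    (hw : 0 ≤ w) (hT : 0 < T) (hwT : w ≤ T) :
    Antitone fun κ => tiltedIntegral p N κ w / tiltedIntegral p N κ T := by
  intro κ κ' hκ
  dsimp only
  rw [div_le_div_iff₀ (tiltedIntegral_pos hp N κ' hT) (tiltedIntegral_pos hp N κ hT),
    ← tiltedIntegral_add hp N κ w T, ← tiltedIntegral_add hp N κ' w T]
  set E := Real.exp (2 * (κ' - κ) * w) with hE
  have h1 : tiltedIntegral p N κ' w ≤ E * tiltedIntegral p N κ w := by
    rw [tiltedIntegral, tiltedIntegral, ← intervalIntegral.integral_const_mul]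
    refine intervalIntegral.integral_mono_on hw (intervalIntegrable_tilted_integrand hp N κ' _ _)
      ((intervalIntegrable_tilted_integrand hp N κ _ _).const_mul _) fun t ht => ?_
    rw [hE, ← Real.exp_add, Real.exp_le_exp]
    nlinarith [ht.2]
  have h2 : E * (∫ t in w..T, Real.exp (-N * p t + 2 * κ * t)) ≤
      ∫ t in w..T, Real.exp (-N * p t + 2 * κ' * t) := by
    rw [← intervalIntegral.integral_const_mul]
    refine intervalIntegral.integral_mono_on hwT
      ((intervalIntegrable_tilted_integrand hp N κ _ _).const_mul _)
      (intervalIntegrable_tilted_integrand hp N κ' _ _) fun t ht => ?_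
    rw [hE, ← Real.exp_add, Real.exp_le_exp]
    nlinarith [ht.1]
  have h3 := tiltedIntegral_nonneg p N κ hw
  have h4 : 0 ≤ ∫ t in w..T, Real.exp (-N * p t + 2 * κ * t) :=
    intervalIntegral.integral_nonneg hwT fun _ _ => (Real.exp_pos _).le
  have h5 := mul_le_mul_of_nonneg_right h1 h4
  have h6 := mul_le_mul_of_nonneg_left h2 h3
  nlinarith

theorem tiltedIntegral_le_mul_exp {p : ℝ → ℝ} (hp : Continuous p) {N κ w : ℝ} (hN : 0 ≤ N)
    (hκ : 0 ≤ κ) (hw : 0 ≤ w) (hp0 : ∀ t, 0 ≤ t → t ≤ w → 0 ≤ p t) :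
    tiltedIntegral p N κ w ≤ w * Real.exp (2 * κ * w) := by
  calc tiltedIntegral p N κ w ≤ ∫ _ in (0 : ℝ)..w, Real.exp (2 * κ * w) := by
        refine intervalIntegral.integral_mono_on hw (intervalIntegrable_tilted_integrand hp N κ _ _)
          (by simp) fun t ht => ?_
        rw [Real.exp_le_exp]
        nlinarith [mul_nonneg hN (hp0 t ht.1 ht.2), mul_le_mul_of_nonneg_left ht.2 hκ]
    _ = w * Real.exp (2 * κ * w) := by simp

theorem le_tiltedIntegral {p : ℝ → ℝ} (hp : Continuous p) {N κ w A : ℝ} (hN : 0 ≤ N)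
    (hκ : 0 ≤ κ) (hw : 0 ≤ w) (hA : 0 ≤ A) (hpA : ∀ t, 0 ≤ t → t ≤ w → p t ≤ A * t ^ 2) :
    w * Real.exp (-(N * A * w ^ 2)) ≤ tiltedIntegral p N κ w := by
  calc w * Real.exp (-(N * A * w ^ 2)) = ∫ _ in (0 : ℝ)..w, Real.exp (-(N * A * w ^ 2)) := by simp
    _ ≤ tiltedIntegral p N κ w := by
        refine intervalIntegral.integral_mono_on hw (by simp)
          (intervalIntegrable_tilted_integrand hp N κ _ _) fun t ht => ?_
        rw [Real.exp_le_exp]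
        have h1 : p t ≤ A * w ^ 2 := (hpA t ht.1 ht.2).trans
          (mul_le_mul_of_nonneg_left (pow_le_pow_left₀ ht.1 ht.2 2) hA)
        nlinarith [mul_le_mul_of_nonneg_left h1 hN, mul_nonneg hκ ht.1]

theorem sqrt_mul_tiltedIntegral (p : ℝ → ℝ) {N : ℝ} (hN : 0 < N) (κ s : ℝ) :
    √N * tiltedIntegral p N (κ * √N) s =
      ∫ u in (0 : ℝ)..s * √N, Real.exp (-N * p (u / √N) + 2 * κ * u) := by
  have h : √N ≠ 0 := (Real.sqrt_pos.2 hN).ne'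
  have := intervalIntegral.mul_integral_comp_mul_right (a := 0) (b := s)
    (f := fun u => Real.exp (-N * p (u / √N) + 2 * κ * u)) (√N)
  rw [zero_mul] at this
  rw [← this, tiltedIntegral]
  congr 2
  ext t
  rw [mul_div_cancel_right₀ _ h]
  ring_nf

/-- A Gaussian lower bound for the normalising integral, uniform in the tilt. -/
theorem exp_le_sqrt_mul_tiltedIntegral {p : ℝ → ℝ} (hp : Continuous p) {N κ T A : ℝ} (hN : 0 < N)
    (hκ : 0 ≤ κ) (hκN : κ ≤ √N) (hA : 0 < A) (hAT : 2 ≤ A * T) (hNT : 2 ≤ T * √N)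
    (hpA : ∀ t, 0 ≤ t → t ≤ T → p t ≤ A * t ^ 2) :
    Real.exp (κ ^ 2 / A - A) ≤ √N * tiltedIntegral p N (κ * √N) T := by
  have hs : 0 < √N := Real.sqrt_pos.2 hN
  rw [sqrt_mul_tiltedIntegral p hN]
  have hcont : Continuous fun u => Real.exp (-N * p (u / √N) + 2 * κ * u) := by fun_prop
  have hm : κ / A + 1 ≤ T * √N := by
    have : κ / A ≤ T * √N / 2 := by
      rw [div_le_iff₀ hA]
      nlinarith
    linarith
  have hm0 : 0 ≤ κ / A := by positivity
  calc Real.exp (κ ^ 2 / A - A) = ∫ _ in (κ / A)..(κ / A + 1), Real.exp (κ ^ 2 / A - A) := by simp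
    _ ≤ ∫ u in (κ / A)..(κ / A + 1), Real.exp (-N * p (u / √N) + 2 * κ * u) := by
        refine intervalIntegral.integral_mono_on (by linarith) (by simp)
          (hcont.intervalIntegrable _ _) fun u hu => ?_
        rw [Real.exp_le_exp]
        have h1 : p (u / √N) ≤ A * (u / √N) ^ 2 := by
          refine hpA _ (div_nonneg (hm0.trans hu.1) hs.le) ?_
          rw [div_le_iff₀ hs]
          exact hu.2.trans hm
        have h2 : N * p (u / √N) ≤ A * u ^ 2 := by
          calc N * p (u / √N) ≤ N * (A * (u / √N) ^ 2) := mul_le_mul_of_nonneg_left h1 hN.le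
            _ = A * u ^ 2 := by
              rw [div_pow, Real.sq_sqrt hN.le]
              field_simp
        have h3 : (u - κ / A) ^ 2 ≤ 1 := by
          have := hu.1
          have := hu.2
          nlinarith
        have h4 : 2 * κ * u - A * u ^ 2 = κ ^ 2 / A - A * (u - κ / A) ^ 2 := by
          field_simp
          ring
        nlinarith
    _ ≤ _ := intervalIntegral.integral_mono_interval hm0 (by linarith) hm
        (Eventually.of_forall fun _ => (Real.exp_pos _).le) (hcont.intervalIntegrable _ _)

/-- The half-line Gaussian integral `∫₀^∞ e^{2κu − bu²} du`. -/
noncomputable def halfGaussian (b κ : ℝ) : ℝ :=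
  ∫ u in Set.Ioi (0 : ℝ), Real.exp (2 * κ * u - b * u ^ 2)

theorem exp_quadratic_eq {b : ℝ} (hb : 0 < b) (κ u : ℝ) :
    Real.exp (2 * κ * u - b * u ^ 2) =
      Real.exp (κ ^ 2 / b) * Real.exp (-b * (u - κ / b) ^ 2) := by
  rw [← Real.exp_add]
  congr 1
  field_simp
  ring

theorem integrable_exp_quadratic {b : ℝ} (hb : 0 < b) (κ : ℝ) :
    Integrable fun u : ℝ => Real.exp (2 * κ * u - b * u ^ 2) := by
  simp_rw [exp_quadratic_eq hb κ]
  exact ((integrable_exp_neg_mul_sq hb).comp_sub_right (κ / b)).const_mul _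

theorem halfGaussian_pos {b : ℝ} (hb : 0 < b) (κ : ℝ) : 0 < halfGaussian b κ := by
  refine (setIntegral_pos_iff_support_of_nonneg_ae
    (Eventually.of_forall fun _ => (Real.exp_pos _).le)
    (integrable_exp_quadratic hb κ).integrableOn).2 ?_
  have : Function.support (fun u : ℝ => Real.exp (2 * κ * u - b * u ^ 2)) = Set.univ := by
    ext u
    simp [Real.exp_ne_zero]
  simp [this]

theorem halfGaussian_eq {b : ℝ} (hb : 0 < b) (κ : ℝ) :
    halfGaussian b κ = Real.exp (κ ^ 2 / b) *
      (halfGaussian b 0 + ∫ v in (0 : ℝ)..κ / b, Real.exp (-b * v ^ 2)) := by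
  have hI := fun u v : ℝ => (show Continuous fun v : ℝ => Real.exp (-b * v ^ 2) by
    fun_prop).intervalIntegrable (μ := volume) u v
  have h1 : Tendsto (fun M : ℝ => ∫ u in (0 : ℝ)..M, Real.exp (2 * κ * u - b * u ^ 2)) atTop
      (𝓝 (halfGaussian b κ)) :=
    intervalIntegral_tendsto_integral_Ioi 0 (integrable_exp_quadratic hb κ).integrableOn tendsto_id
  have h0 : Tendsto (fun M : ℝ => ∫ v in (0 : ℝ)..M - κ / b, Real.exp (-b * v ^ 2)) atTop
      (𝓝 (halfGaussian b 0)) := by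
    have := intervalIntegral_tendsto_integral_Ioi (0 : ℝ)
      (integrable_exp_quadratic hb 0).integrableOn
      (tendsto_atTop_add_const_right atTop (-(κ / b)) tendsto_id)
    simpa [halfGaussian, sub_eq_add_neg] using this
  have h2 : ∀ M : ℝ, ∫ u in (0 : ℝ)..M, Real.exp (2 * κ * u - b * u ^ 2) =
      Real.exp (κ ^ 2 / b) * ((∫ v in (0 : ℝ)..M - κ / b, Real.exp (-b * v ^ 2)) +
        ∫ v in (0 : ℝ)..κ / b, Real.exp (-b * v ^ 2)) := by
    intro M
    simp_rw [exp_quadratic_eq hb κ]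
    rw [intervalIntegral.integral_const_mul,
      intervalIntegral.integral_comp_sub_right (fun v => Real.exp (-b * v ^ 2)) (κ / b), zero_sub,
      ← intervalIntegral.integral_add_adjacent_intervals (hI (-(κ / b)) 0) (hI 0 (M - κ / b)),
      add_comm]
    congr 2
    have := intervalIntegral.integral_comp_neg (a := 0) (b := κ / b)
      fun v : ℝ => Real.exp (-b * v ^ 2)
    simpa using this.symm
  simp_rw [h2] at h1
  exact tendsto_nhds_unique h1 ((h0.add_const _).const_mul _)

theorem integral_inv_halfGaussian {b : ℝ} (hb : 0 < b) :
    ∫ κ in Set.Ioi (0 : ℝ), (halfGaussian b κ)⁻¹ = b * Real.log 2 := by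
  set H : ℝ → ℝ := fun κ => halfGaussian b 0 + ∫ v in (0 : ℝ)..κ / b, Real.exp (-b * v ^ 2) with hH
  have hF : ∀ κ, halfGaussian b κ = Real.exp (κ ^ 2 / b) * H κ := halfGaussian_eq hb
  have hHpos : ∀ κ, 0 < H κ := fun κ =>
    pos_of_mul_pos_right (hF κ ▸ halfGaussian_pos hb κ) (Real.exp_pos _).le
  have hderiv : ∀ κ, HasDerivAt (fun κ => b * Real.log (H κ)) (halfGaussian b κ)⁻¹ κ := by
    intro κ
    have hc : Continuous fun v : ℝ => Real.exp (-b * v ^ 2) := by fun_prop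
    have h1 : HasDerivAt H (Real.exp (-b * (κ / b) ^ 2) * (1 / b)) κ :=
      (HasDerivAt.comp κ (intervalIntegral.integral_hasDerivAt_right (hc.intervalIntegrable 0 _)
        hc.stronglyMeasurable.stronglyMeasurableAtFilter hc.continuousAt)
        ((hasDerivAt_id κ).div_const b)).const_add _
    refine ((h1.log (hHpos κ).ne').const_mul b).congr_deriv ?_
    have h2 : -b * (κ / b) ^ 2 = -(κ ^ 2 / b) := by
      field_simp
    have := (hHpos κ).ne'
    rw [hF, h2, Real.exp_neg]
    field_simp
  have hlim : Tendsto H atTop (𝓝 (halfGaussian b 0 + halfGaussian b 0)) := by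
    have := intervalIntegral_tendsto_integral_Ioi (0 : ℝ)
      (integrable_exp_quadratic hb 0).integrableOn
      (tendsto_id.atTop_div_const hb)
    simpa [halfGaussian, H] using this.const_add (halfGaussian b 0)
  have h0 := halfGaussian_pos hb 0
  have hlim' : Tendsto (fun κ => b * Real.log (H κ)) atTop
      (𝓝 (b * Real.log (halfGaussian b 0 + halfGaussian b 0))) :=
    (hlim.log (by positivity)).const_mul b
  rw [integral_Ioi_of_hasDerivAt_of_nonneg' (fun κ _ => hderiv κ)
    (fun κ _ => (inv_pos.2 (halfGaussian_pos hb κ)).le) hlim']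
  have hH0 : H 0 = halfGaussian b 0 := by simp [H]
  rw [hH0, ← two_mul, Real.log_mul two_ne_zero h0.ne']
  ring

theorem tendsto_sqrt_mul_tiltedIntegral {p : ℝ → ℝ} {T b : ℝ} (hp : Continuous p) (hT : 0 < T)
    (hp0 : p 0 = 0) (hpos : ∀ t, 0 < t → t ≤ T → 0 < p t) (hb : 0 < b)
    (hlim : Tendsto (fun t => p t / t ^ 2) (𝓝[>] 0) (𝓝 b)) (κ : ℝ) :
    Tendsto (fun N => √N * tiltedIntegral p N (κ * √N) T) atTop (𝓝 (halfGaussian b κ)) := by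
  obtain ⟨a, ha, A, -, hpa⟩ := exists_quadratic_bounds hp hT hp0 hpos hb hlim
  have hsqrt : Tendsto (fun N : ℝ => √N) atTop atTop := Real.tendsto_sqrt_atTop
  set φ : ℝ → ℝ → ℝ := fun N => Set.indicator (Set.Ioc 0 (T * √N))
    fun u => Real.exp (-N * p (u / √N) + 2 * κ * u) with hφ
  have hmain : Tendsto (fun N => ∫ u in Set.Ioi (0 : ℝ), φ N u) atTop (𝓝 (halfGaussian b κ)) := by
    refine tendsto_integral_filter_of_dominated_convergence
      (fun u => Real.exp (2 * κ * u - a * u ^ 2)) ?_ ?_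
      (integrable_exp_quadratic ha κ).integrableOn ?_
    · refine Eventually.of_forall fun N => ?_
      have : Continuous fun u => Real.exp (-N * p (u / √N) + 2 * κ * u) := by fun_prop
      exact (this.measurable.indicator measurableSet_Ioc).aestronglyMeasurable
    · filter_upwards [eventually_gt_atTop 0] with N hN
      refine Eventually.of_forall fun u => ?_
      have hs : 0 < √N := Real.sqrt_pos.2 hN
      by_cases hu : u ∈ Set.Ioc 0 (T * √N)
      · rw [hφ]
        dsimp only
        rw [Set.indicator_of_mem hu, Real.norm_of_nonneg (Real.exp_pos _).le, Real.exp_le_exp]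
        have h1 := (hpa (u / √N) (div_nonneg hu.1.le hs.le) ((div_le_iff₀ hs).2 hu.2)).1
        have h2 : a * u ^ 2 ≤ N * p (u / √N) := by
          calc a * u ^ 2 = N * (a * (u / √N) ^ 2) := by
                rw [div_pow, Real.sq_sqrt hN.le]
                field_simp
            _ ≤ _ := mul_le_mul_of_nonneg_left h1 hN.le
        linarith
      · simp [hφ, Set.indicator_of_notMem hu, (Real.exp_pos _).le]
    · refine (ae_restrict_mem measurableSet_Ioi).mono fun u hu => ?_
      rw [Set.mem_Ioi] at hu
      have h0 : Tendsto (fun N : ℝ => u / √N) atTop (𝓝[>] 0) := by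
        refine tendsto_nhdsWithin_iff.2 ⟨hsqrt.const_div_atTop u, ?_⟩
        filter_upwards [eventually_gt_atTop 0] with N hN
        exact div_pos hu (Real.sqrt_pos.2 hN)
      have h1 : Tendsto (fun N : ℝ => Real.exp (2 * κ * u - p (u / √N) / (u / √N) ^ 2 * u ^ 2))
          atTop (𝓝 (Real.exp (2 * κ * u - b * u ^ 2))) :=
        (Real.continuous_exp.tendsto _).comp (((hlim.comp h0).mul_const _).const_sub _)
      refine h1.congr' ?_
      filter_upwards [eventually_gt_atTop 0,
        (hsqrt.const_mul_atTop hT).eventually_ge_atTop u] with N hN huN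
      rw [hφ]
      dsimp only
      rw [Set.indicator_of_mem (Set.mem_Ioc.2 ⟨hu, huN⟩)]
      have hs : 0 < √N := Real.sqrt_pos.2 hN
      congr 1
      rw [div_pow, Real.sq_sqrt hN.le]
      field_simp
      ring
  refine hmain.congr' ?_
  filter_upwards [eventually_gt_atTop 0] with N hN
  have hs : 0 < √N := Real.sqrt_pos.2 hN
  rw [sqrt_mul_tiltedIntegral p hN, intervalIntegral.integral_of_le (by positivity), hφ,
    setIntegral_indicator measurableSet_Ioc, Set.inter_eq_right.2 Set.Ioc_subset_Ioi_self]

theorem tendsto_mul_tiltedIntegral {ι : Type*} {l : Filter ι} {N w : ι → ℝ} {p : ℝ → ℝ}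
    {T A c : ℝ} (hp : Continuous p) (hT : 0 < T) (hA : 0 ≤ A)
    (hpA : ∀ t, 0 ≤ t → t ≤ T → 0 ≤ p t ∧ p t ≤ A * t ^ 2) (hN : Tendsto N l atTop)
    (hw0 : ∀ᶠ i in l, 0 ≤ w i) (hw : Tendsto (fun i => N i * w i) l (𝓝 c)) {κ : ℝ} (hκ : 0 ≤ κ) :
    Tendsto (fun i => N i * tiltedIntegral p (N i) (κ * √(N i)) (w i)) l (𝓝 c) := by
  have hNpos : ∀ᶠ i in l, 0 < N i := hN.eventually_gt_atTop 0
  have hwlim : Tendsto w l (𝓝 0) := by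
    refine (hw.div_atTop hN).congr' ?_
    filter_upwards [hNpos] with i hi
    field_simp
  have hsw : Tendsto (fun i => √(N i) * w i) l (𝓝 0) := by
    refine (hw.div_atTop (Real.tendsto_sqrt_atTop.comp hN)).congr' ?_
    filter_upwards [hNpos] with i hi
    have hs : 0 < √(N i) := Real.sqrt_pos.2 hi
    rw [Function.comp_apply, div_eq_iff hs.ne']
    linear_combination -(w i) * Real.mul_self_sqrt hi.le
  have hup : Tendsto (fun i => N i * w i * Real.exp (2 * κ * (√(N i) * w i))) l (𝓝 c) := by
    have := hw.mul ((Real.continuous_exp.tendsto _).comp (hsw.const_mul (2 * κ)))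
    simpa using this
  have hlo : Tendsto (fun i => N i * w i * Real.exp (-(A * (N i * w i) * w i))) l (𝓝 c) := by
    have := hw.mul ((Real.continuous_exp.tendsto _).comp (((hw.const_mul A).mul hwlim).neg))
    simpa using this
  have hwT : ∀ᶠ i in l, w i ≤ T := hwlim.eventually_le_const hT
  refine tendsto_of_tendsto_of_tendsto_of_le_of_le' hlo hup ?_ ?_
  · filter_upwards [hNpos, hw0, hwT] with i hi h0 h1
    rw [mul_assoc]
    refine mul_le_mul_of_nonneg_left ?_ hi.le
    have := le_tiltedIntegral hp hi.le (mul_nonneg hκ (Real.sqrt_nonneg (N i))) h0 hA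
      fun t ht0 ht1 => (hpA t ht0 (ht1.trans h1)).2
    refine le_trans (le_of_eq ?_) this
    ring_nf
  · filter_upwards [hNpos, hw0, hwT] with i hi h0 h1
    rw [mul_assoc]
    refine mul_le_mul_of_nonneg_left ?_ hi.le
    have := tiltedIntegral_le_mul_exp hp hi.le (mul_nonneg hκ (Real.sqrt_nonneg (N i))) h0
      fun t ht0 ht1 => (hpA t ht0 (ht1.trans h1)).1
    refine this.trans (le_of_eq ?_)
    ring_nf

section SumLimit

variable {ι : Type*} {l : Filter ι} {N : ι → ℕ} {w : ι → ℝ} {p : ℝ → ℝ} {T b c : ℝ}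

theorem tendsto_sqrt_mul_ratio (hp : Continuous p) (hT : 0 < T)
    (hp0 : p 0 = 0) (hpos : ∀ t, 0 < t → t ≤ T → 0 < p t) (hb : 0 < b)
    (hlim : Tendsto (fun t => p t / t ^ 2) (𝓝[>] 0) (𝓝 b)) (hN : Tendsto N l atTop)
    (hw0 : ∀ᶠ i in l, 0 ≤ w i) (hw : Tendsto (fun i => N i * w i) l (𝓝 c)) {κ : ℝ} (hκ : 0 ≤ κ) :
    Tendsto (fun i => √(N i : ℝ) * (tiltedIntegral p (N i) (κ * √(N i : ℝ)) (w i) /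
      tiltedIntegral p (N i) (κ * √(N i : ℝ)) T)) l (𝓝 (c * (halfGaussian b κ)⁻¹)) := by
  obtain ⟨a, ha, A, hA, hpa⟩ := exists_quadratic_bounds hp hT hp0 hpos hb hlim
  have hN' : Tendsto (fun i => (N i : ℝ)) l atTop := tendsto_natCast_atTop_atTop.comp hN
  have h1 := tendsto_mul_tiltedIntegral (N := fun i => (N i : ℝ)) hp hT hA.le
    (fun t h0 h1 => ⟨(by positivity : 0 ≤ a * t ^ 2).trans (hpa t h0 h1).1, (hpa t h0 h1).2⟩)
    hN' hw0 hw hκ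
  have h2 := (tendsto_sqrt_mul_tiltedIntegral hp hT hp0 hpos hb hlim κ).comp hN'
  refine (h1.mul (h2.inv₀ (halfGaussian_pos hb κ).ne')).congr' ?_
  filter_upwards [hN'.eventually_gt_atTop 0] with i hi
  have hs : 0 < √(N i : ℝ) := Real.sqrt_pos.2 hi
  have hJ := tiltedIntegral_pos hp (N i) (κ * √(N i : ℝ)) hT
  simp only [Function.comp_apply]
  field_simp
  rw [Real.sq_sqrt hi.le]

theorem tendsto_integral_ratio [l.IsCountablyGenerated] (hp : Continuous p) (hT : 0 < T)
    (hp0 : p 0 = 0) (hpos : ∀ t, 0 < t → t ≤ T → 0 < p t) (hb : 0 < b)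
    (hlim : Tendsto (fun t => p t / t ^ 2) (𝓝[>] 0) (𝓝 b)) (hN : Tendsto N l atTop)
    (hw0 : ∀ᶠ i in l, 0 ≤ w i) (hw : Tendsto (fun i => N i * w i) l (𝓝 c)) :
    Tendsto (fun i => ∫ κ in (0 : ℝ)..N i,
      tiltedIntegral p (N i) κ (w i) / tiltedIntegral p (N i) κ T) l
      (𝓝 (c * (b * Real.log 2))) := by
  obtain ⟨a, ha, A, hA, hpa⟩ := exists_quadratic_bounds hp hT hp0 hpos hb hlim
  have hN' : Tendsto (fun i => (N i : ℝ)) l atTop := tendsto_natCast_atTop_atTop.comp hN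
  have hNpos := hN'.eventually_gt_atTop 0
  have hwlim : Tendsto w l (𝓝 0) := by
    refine (hw.div_atTop hN').congr' ?_
    filter_upwards [hNpos] with i hi
    field_simp
  set B := max A (2 / T)
  have hBpos : 0 < B := hA.trans_le (le_max_left _ _)
  have hBT : 2 ≤ B * T := (div_le_iff₀ hT).1 (le_max_right _ _)
  set C := c + 1
  set φ : ι → ℝ → ℝ := fun i => Set.indicator (Set.Ioc 0 √(N i : ℝ)) fun κ =>
    √(N i : ℝ) * (tiltedIntegral p (N i) (κ * √(N i : ℝ)) (w i) /
      tiltedIntegral p (N i) (κ * √(N i : ℝ)) T) with hφ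
  have hsqrt : Tendsto (fun i => √(N i : ℝ)) l atTop := Real.tendsto_sqrt_atTop.comp hN'
  have hmain : Tendsto (fun i => ∫ κ in Set.Ioi (0 : ℝ), φ i κ) l
      (𝓝 (∫ κ in Set.Ioi (0 : ℝ), c * (halfGaussian b κ)⁻¹)) := by
    refine tendsto_integral_filter_of_dominated_convergence
      (fun κ => |C| * Real.exp (2 * |C|) * Real.exp B * Real.exp (-(1 / B) * κ ^ 2)) ?_ ?_
      ((integrable_exp_neg_mul_sq (by positivity)).const_mul _).integrableOn ?_
    · refine Eventually.of_forall fun i => ?_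
      refine Measurable.aestronglyMeasurable (Measurable.indicator ?_ measurableSet_Ioc)
      have h1 := (continuous_tiltedIntegral hp (N i) (w i)).measurable
      have h2 := (continuous_tiltedIntegral hp (N i) T).measurable
      have h3 : Measurable fun κ : ℝ => κ * √(N i : ℝ) := by fun_prop
      exact ((h1.comp h3).div (h2.comp h3)).const_mul _
    · filter_upwards [hNpos, hw0, hw.eventually_le_const (lt_add_one c),
        hwlim.eventually_le_const hT, (hsqrt.const_mul_atTop hT).eventually_ge_atTop 2]
        with i hi h0 hC hwT h2
      refine Eventually.of_forall fun κ => ?_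
      have hs : 0 < √(N i : ℝ) := Real.sqrt_pos.2 hi
      by_cases hκ : κ ∈ Set.Ioc 0 √(N i : ℝ)
      · have hκs : 0 ≤ κ * √(N i : ℝ) := mul_nonneg hκ.1.le hs.le
        have hJ := tiltedIntegral_pos hp (N i) (κ * √(N i : ℝ)) hT
        have hJw := tiltedIntegral_nonneg p (N i) (κ * √(N i : ℝ)) h0
        rw [hφ]
        dsimp only
        rw [Set.indicator_of_mem hκ, Real.norm_of_nonneg (by positivity)]
        have hC' : (N i : ℝ) * w i ≤ |C| := hC.trans (le_abs_self _)
        have hnum : (N i : ℝ) * tiltedIntegral p (N i) (κ * √(N i : ℝ)) (w i) ≤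
            |C| * Real.exp (2 * |C|) := by
          have h3 := tiltedIntegral_le_mul_exp hp hi.le hκs h0 fun t ht0 ht1 =>
            (by positivity : 0 ≤ a * t ^ 2).trans (hpa t ht0 (ht1.trans hwT)).1
          have h4 : κ * √(N i : ℝ) * w i ≤ |C| := by
            refine le_trans (mul_le_mul_of_nonneg_right ?_ h0) hC'
            calc κ * √(N i : ℝ) ≤ √(N i : ℝ) * √(N i : ℝ) :=
                  mul_le_mul_of_nonneg_right hκ.2 hs.le
              _ = N i := Real.mul_self_sqrt hi.le
          calc (N i : ℝ) * tiltedIntegral p (N i) (κ * √(N i : ℝ)) (w i)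
              ≤ N i * (w i * Real.exp (2 * (κ * √(N i : ℝ)) * w i)) :=
                mul_le_mul_of_nonneg_left h3 hi.le
            _ = N i * w i * Real.exp (2 * (κ * √(N i : ℝ) * w i)) := by ring_nf
            _ ≤ |C| * Real.exp (2 * |C|) := by gcongr
        have hden := exp_le_sqrt_mul_tiltedIntegral hp hi hκ.1.le hκ.2 hBpos hBT h2
          fun t ht0 ht1 => (hpa t ht0 ht1).2.trans
            (mul_le_mul_of_nonneg_right (le_max_left _ _) (sq_nonneg t))
        calc √(N i : ℝ) * (tiltedIntegral p (N i) (κ * √(N i : ℝ)) (w i) /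
              tiltedIntegral p (N i) (κ * √(N i : ℝ)) T)
            = N i * tiltedIntegral p (N i) (κ * √(N i : ℝ)) (w i) /
              (√(N i : ℝ) * tiltedIntegral p (N i) (κ * √(N i : ℝ)) T) := by
              field_simp
              rw [Real.sq_sqrt hi.le, mul_comm (N i : ℝ)]
          _ ≤ |C| * Real.exp (2 * |C|) / Real.exp (κ ^ 2 / B - B) := by gcongr
          _ = |C| * Real.exp (2 * |C|) * Real.exp B * Real.exp (-(1 / B) * κ ^ 2) := by
              rw [div_eq_mul_inv, ← Real.exp_neg, mul_assoc (|C| * Real.exp (2 * |C|)),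
                ← Real.exp_add]
              ring_nf
      · rw [hφ]
        dsimp only
        rw [Set.indicator_of_notMem hκ, norm_zero]
        positivity
    · refine (ae_restrict_mem measurableSet_Ioi).mono fun κ hκ => ?_
      rw [Set.mem_Ioi] at hκ
      refine (tendsto_sqrt_mul_ratio hp hT hp0 hpos hb hlim hN hw0 hw hκ.le).congr' ?_
      filter_upwards [hsqrt.eventually_ge_atTop κ] with i hi
      rw [hφ]
      dsimp only
      rw [Set.indicator_of_mem (Set.mem_Ioc.2 ⟨hκ, hi⟩)]
  rw [integral_const_mul, integral_inv_halfGaussian hb] at hmain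
  refine hmain.congr fun i => ?_
  have h1 := intervalIntegral.mul_integral_comp_mul_right (a := 0) (b := √(N i : ℝ))
    (f := fun κ => tiltedIntegral p (N i) κ (w i) / tiltedIntegral p (N i) κ T) √(N i : ℝ)
  rw [zero_mul, Real.mul_self_sqrt (Nat.cast_nonneg _)] at h1
  rw [← h1, hφ, setIntegral_indicator measurableSet_Ioc,
    Set.inter_eq_right.2 Set.Ioc_subset_Ioi_self, integral_const_mul,
    intervalIntegral.integral_of_le (Real.sqrt_nonneg _)]

theorem tendsto_ratio_zero (hp : Continuous p) (hT : 0 < T)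
    (hp0 : p 0 = 0) (hpos : ∀ t, 0 < t → t ≤ T → 0 < p t) (hb : 0 < b)
    (hlim : Tendsto (fun t => p t / t ^ 2) (𝓝[>] 0) (𝓝 b)) (hN : Tendsto N l atTop)
    (hw0 : ∀ᶠ i in l, 0 ≤ w i) (hw : Tendsto (fun i => N i * w i) l (𝓝 c)) :
    Tendsto (fun i => tiltedIntegral p (N i) 0 (w i) / tiltedIntegral p (N i) 0 T) l (𝓝 0) := by
  have hN' : Tendsto (fun i => (N i : ℝ)) l atTop := tendsto_natCast_atTop_atTop.comp hN
  refine ((tendsto_sqrt_mul_ratio hp hT hp0 hpos hb hlim hN hw0 hw le_rfl).div_atTop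
    (Real.tendsto_sqrt_atTop.comp hN')).congr' ?_
  filter_upwards [hN'.eventually_gt_atTop 0] with i hi
  have hs : 0 < √(N i : ℝ) := Real.sqrt_pos.2 hi
  simp only [Function.comp_apply, zero_mul]
  field_simp

theorem tendsto_sum_ratio [l.IsCountablyGenerated] (hp : Continuous p) (hT : 0 < T)
    (hp0 : p 0 = 0) (hpos : ∀ t, 0 < t → t ≤ T → 0 < p t) (hb : 0 < b)
    (hlim : Tendsto (fun t => p t / t ^ 2) (𝓝[>] 0) (𝓝 b)) (hN : Tendsto N l atTop)
    (hw0 : ∀ᶠ i in l, 0 ≤ w i) (hwT : ∀ᶠ i in l, w i ≤ T)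
    (hw : Tendsto (fun i => N i * w i) l (𝓝 c)) :
    Tendsto (fun i => ∑ k ∈ Finset.range (N i),
      tiltedIntegral p (N i) k (w i) / tiltedIntegral p (N i) k T) l
      (𝓝 (c * (b * Real.log 2))) := by
  have hI := tendsto_integral_ratio hp hT hp0 hpos hb hlim hN hw0 hw
  have hup := hI.add (tendsto_ratio_zero hp hT hp0 hpos hb hlim hN hw0 hw)
  rw [add_zero] at hup
  refine tendsto_of_tendsto_of_tendsto_of_le_of_le' hI hup ?_ ?_
  · filter_upwards [hw0, hwT] with i h0 h1
    have := AntitoneOn.integral_le_sum (x₀ := 0) (a := N i)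
      ((antitone_tiltedIntegral_div hp (N i) h0 hT h1).antitoneOn _)
    simpa using this
  · filter_upwards [hw0, hwT] with i h0 h1
    set x : ℝ → ℝ := fun κ => tiltedIntegral p (N i) κ (w i) / tiltedIntegral p (N i) κ T
    have hx : ∀ κ, 0 ≤ x κ := fun κ =>
      div_nonneg (tiltedIntegral_nonneg p _ _ h0) (tiltedIntegral_nonneg p _ _ hT.le)
    have h2 := AntitoneOn.sum_le_integral (x₀ := 0) (a := N i)
      ((antitone_tiltedIntegral_div hp (N i) h0 hT h1).antitoneOn _)
    simp only [zero_add] at h2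
    calc ∑ k ∈ Finset.range (N i), x k ≤ ∑ k ∈ Finset.range (N i + 1), x k :=
          Finset.sum_le_sum_of_subset_of_nonneg (Finset.range_subset_range.2 (Nat.le_succ _))
            fun _ _ _ => hx _
      _ = (∑ k ∈ Finset.range (N i), x (k + 1 : ℕ)) + x 0 := by
          rw [Finset.sum_range_succ']
          simp
      _ ≤ _ := by
          gcongr

end SumLimit

theorem exp_neg_div_one_sub_le {x ε : ℝ} (hx : 0 ≤ x) (hxε : x ≤ ε) (hε : ε < 1) :
    Real.exp (-(x / (1 - ε))) ≤ 1 - x := by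
  have h1 : 0 < 1 - x := by linarith
  have h2 : x / (1 - x) ≤ x / (1 - ε) := by
    gcongr
  rw [Real.exp_neg]
  refine inv_le_of_inv_le₀ h1 ?_
  calc (1 - x)⁻¹ = x / (1 - x) + 1 := by
        field_simp
        ring
    _ ≤ x / (1 - ε) + 1 := by linarith
    _ ≤ _ := Real.add_one_le_exp _

theorem tendsto_prod_one_sub {ι : Type*} {l : Filter ι} {N : ι → ℕ} {x : ι → ℕ → ℝ} {ε : ι → ℝ}
    {S : ℝ} (hx : ∀ᶠ i in l, ∀ k < N i, 0 ≤ x i k ∧ x i k ≤ ε i) (hε : Tendsto ε l (𝓝 0))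
    (hS : Tendsto (fun i => ∑ k ∈ Finset.range (N i), x i k) l (𝓝 S)) :
    Tendsto (fun i => ∏ k ∈ Finset.range (N i), (1 - x i k)) l (𝓝 (Real.exp (-S))) := by
  have hlo : Tendsto (fun i => Real.exp (-((∑ k ∈ Finset.range (N i), x i k) / (1 - ε i)))) l
      (𝓝 (Real.exp (-S))) := by
    have := hS.div (hε.const_sub 1) (by norm_num)
    rw [sub_zero, div_one] at this
    exact (Real.continuous_exp.tendsto _).comp this.neg
  have hup : Tendsto (fun i => Real.exp (-∑ k ∈ Finset.range (N i), x i k)) l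
      (𝓝 (Real.exp (-S))) := (Real.continuous_exp.tendsto _).comp hS.neg
  have hε1 : ∀ᶠ i in l, ε i < 1 := hε.eventually_lt_const one_pos
  refine tendsto_of_tendsto_of_tendsto_of_le_of_le' hlo hup ?_ ?_
  · filter_upwards [hx, hε1] with i hi h1
    rw [Finset.sum_div, ← Finset.sum_neg_distrib, Real.exp_sum]
    refine Finset.prod_le_prod (fun _ _ => (Real.exp_pos _).le) fun k hk => ?_
    obtain ⟨h2, h3⟩ := hi k (Finset.mem_range.1 hk)
    exact exp_neg_div_one_sub_le h2 h3 h1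
  · filter_upwards [hx, hε1] with i hi h1
    rw [← Finset.sum_neg_distrib, Real.exp_sum]
    refine Finset.prod_le_prod (fun k hk => ?_) fun k _ => Real.one_sub_le_exp_neg _
    linarith [(hi k (Finset.mem_range.1 hk)).2]

/-- The potential in the logarithmic variable `r = R₀ e^{−t}`, with its tangent line at `0`
removed. -/
noncomputable def logPotential (Q : ℝ → ℝ) (R₀ t : ℝ) : ℝ :=
  Q (R₀ * Real.exp (-t)) - Q R₀ + 2 * t

section LogPotential

variable {Q : ℝ → ℝ} {R₀ : ℝ}

theorem hasDerivAt_mul_exp_neg (R₀ t : ℝ) :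
    HasDerivAt (fun t => R₀ * Real.exp (-t)) (-(R₀ * Real.exp (-t))) t := by
  simpa using ((hasDerivAt_neg t).exp).const_mul R₀

theorem hasDerivAt_logPotential (hQ : ∀ r > 0, DifferentiableAt ℝ Q r) (hR : 0 < R₀) (t : ℝ) :
    HasDerivAt (logPotential Q R₀)
      (2 - R₀ * Real.exp (-t) * deriv Q (R₀ * Real.exp (-t))) t := by
  have h1 := (hQ (R₀ * Real.exp (-t)) (by positivity)).hasDerivAt.comp t
    (hasDerivAt_mul_exp_neg R₀ t)
  refine ((h1.sub_const (Q R₀)).add ((hasDerivAt_id t).const_mul 2)).congr_deriv ?_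
  ring

theorem hasDerivAt_mul_deriv (hQ' : ∀ r > 0, DifferentiableAt ℝ (deriv Q) r) {r : ℝ} (hr : 0 < r) :
    HasDerivAt (fun r => r * deriv Q r) (r * (deriv (deriv Q) r + deriv Q r / r)) r := by
  refine ((hasDerivAt_id r).mul (hQ' r hr).hasDerivAt).congr_deriv ?_
  simp only [id]
  field_simp
  ring

theorem mul_deriv_lt_two (hQ' : ∀ r > 0, DifferentiableAt ℝ (deriv Q) r)
    (hsub : ∀ r > (0 : ℝ), 0 ≤ deriv (deriv Q) r + deriv Q r / r) (hR : 0 < R₀)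
    (hR₀ : R₀ * deriv Q R₀ = 2) (hR₀min : ∀ R > (0 : ℝ), R * deriv Q R = 2 → R₀ ≤ R)
    {r : ℝ} (hr : 0 < r) (hrR : r < R₀) : r * deriv Q r < 2 := by
  have hmono : MonotoneOn (fun r => r * deriv Q r) (Set.Ioi 0) := by
    refine monotoneOn_of_deriv_nonneg (convex_Ioi 0) (fun x hx => ?_) (fun x hx => ?_) fun x hx => ?_
    · exact (hasDerivAt_mul_deriv hQ' hx).continuousAt.continuousWithinAt
    · rw [interior_Ioi] at hx
      exact (hasDerivAt_mul_deriv hQ' hx).differentiableAt.differentiableWithinAt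
    · rw [interior_Ioi] at hx
      rw [(hasDerivAt_mul_deriv hQ' hx).deriv]
      exact mul_nonneg (le_of_lt hx) (hsub x hx)
  refine lt_of_le_of_ne ((hmono hr hR hrR.le).trans hR₀.le) fun h => ?_
  exact absurd (hR₀min r hr h) (not_le.2 hrR)

theorem logPotential_zero (Q : ℝ → ℝ) (R₀ : ℝ) : logPotential Q R₀ 0 = 0 := by
  simp [logPotential]

theorem logPotential_pos (hQ : ∀ r > 0, DifferentiableAt ℝ Q r)
    (hQ' : ∀ r > 0, DifferentiableAt ℝ (deriv Q) r)
    (hsub : ∀ r > (0 : ℝ), 0 ≤ deriv (deriv Q) r + deriv Q r / r) (hR : 0 < R₀)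
    (hR₀ : R₀ * deriv Q R₀ = 2) (hR₀min : ∀ R > (0 : ℝ), R * deriv Q R = 2 → R₀ ≤ R)
    {t : ℝ} (ht : 0 < t) : 0 < logPotential Q R₀ t := by
  have hmono : StrictMonoOn (logPotential Q R₀) (Set.Ici 0) := by
    refine strictMonoOn_of_deriv_pos (convex_Ici 0)
      (fun x _ => (hasDerivAt_logPotential hQ hR x).continuousAt.continuousWithinAt) fun x hx => ?_
    rw [interior_Ici, Set.mem_Ioi] at hx
    rw [(hasDerivAt_logPotential hQ hR x).deriv, sub_pos]
    refine mul_deriv_lt_two hQ' hsub hR hR₀ hR₀min (by positivity) ?_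
    exact mul_lt_of_lt_one_right hR (by simpa using hx)
  simpa [logPotential_zero] using hmono Set.self_mem_Ici ht.le ht

theorem tendsto_logPotential_div_sq (hQ : ∀ r > 0, DifferentiableAt ℝ Q r)
    (hQ' : ∀ r > 0, DifferentiableAt ℝ (deriv Q) r) (hR : 0 < R₀) (hR₀ : R₀ * deriv Q R₀ = 2) :
    Tendsto (fun t => logPotential Q R₀ t / t ^ 2) (𝓝[>] 0)
      (𝓝 (R₀ ^ 2 * (deriv (deriv Q) R₀ + deriv Q R₀ / R₀) / 2)) := by
  set D := deriv (deriv Q) R₀ + deriv Q R₀ / R₀ with hD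
  have hpos : ∀ᶠ t : ℝ in 𝓝[>] 0, 0 < t := eventually_mem_nhdsWithin
  refine HasDerivAt.lhopital_zero_nhdsGT (g' := fun t => 2 * t)
    (Eventually.of_forall fun t => hasDerivAt_logPotential hQ hR t)
    (Eventually.of_forall fun t => by simpa using hasDerivAt_pow 2 t)
    (hpos.mono fun t ht => by positivity) ?_ ?_ ?_
  · have := (hasDerivAt_logPotential hQ hR 0).continuousAt.tendsto
    rw [logPotential_zero] at this
    exact this.mono_left nhdsWithin_le_nhds
  · have : Tendsto (fun t : ℝ => t ^ 2) (𝓝 0) (𝓝 (0 ^ 2)) := (continuous_pow 2).tendsto 0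
    rw [zero_pow two_ne_zero] at this
    exact this.mono_left nhdsWithin_le_nhds
  · have h0 : R₀ * Real.exp (-0) = R₀ := by simp
    have h1 : HasDerivAt (fun t => 2 - R₀ * Real.exp (-t) * deriv Q (R₀ * Real.exp (-t)))
        (R₀ ^ 2 * D) 0 := by
      have h2 : HasDerivAt (fun r => r * deriv Q r) (R₀ * D) (R₀ * Real.exp (-0)) := by
        rw [h0]
        exact hasDerivAt_mul_deriv hQ' hR
      refine ((h2.comp (0 : ℝ) (hasDerivAt_mul_exp_neg R₀ 0)).const_sub 2).congr_deriv ?_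
      rw [h0]
      ring
    have h2 := (hasDerivAt_iff_tendsto_slope_zero.1 h1).mono_left
      (nhdsWithin_mono 0 fun x (hx : 0 < x) => ne_of_gt hx)
    refine (h2.div_const 2).congr' (hpos.mono fun t ht => ?_)
    simp only [zero_add, h0, hR₀, sub_self, sub_zero, smul_eq_mul]
    field_simp

theorem integral_exp_neg_Vnk (hQ : ∀ r > 0, DifferentiableAt ℝ Q r) (hR : 0 < R₀) {n : ℕ}
    (hn : 0 < n) (k : ℕ) (s : ℝ) :
    ∫ r in (R₀ * Real.exp (-s))..R₀, Real.exp (-(n : ℝ) * Vnk Q n k r) =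
      Real.exp (-n * Q R₀ + (2 * n - 2 * k) * Real.log R₀) *
        tiltedIntegral (logPotential Q R₀) n k s := by
  have h1 := intervalIntegral.integral_comp_mul_deriv' (a := s) (b := 0)
    (f := fun t => R₀ * Real.exp (-t)) (f' := fun t => -(R₀ * Real.exp (-t)))
    (g := fun r => Real.exp (-(n : ℝ) * Vnk Q n k r))
    (fun t _ => hasDerivAt_mul_exp_neg R₀ t) (by fun_prop) (by
      rintro _ ⟨t, -, rfl⟩
      have ht : 0 < R₀ * Real.exp (-t) := by positivity
      have hc := (hQ _ ht).continuousAt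
      refine ContinuousAt.continuousWithinAt ?_
      have hl := Real.continuousAt_log ht.ne'
      unfold Vnk
      fun_prop)
  simp only [neg_zero, Real.exp_zero, mul_one] at h1
  rw [← h1, intervalIntegral.integral_symm, ← intervalIntegral.integral_neg, tiltedIntegral,
    ← intervalIntegral.integral_const_mul]
  refine intervalIntegral.integral_congr fun t _ => ?_
  have hn' : (n : ℝ) ≠ 0 := by positivity
  have hR' : R₀ * Real.exp (-t) = Real.exp (Real.log R₀ - t) := by
    rw [sub_eq_add_neg, Real.exp_add, Real.exp_log hR]
  simp only [Function.comp_apply, Vnk, logPotential]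
  rw [mul_neg, neg_neg, hR', Real.log_exp, ← Real.exp_add, ← Real.exp_add]
  congr 1
  field_simp
  ring

theorem xnk_eq (hQ : ∀ r > 0, DifferentiableAt ℝ Q r) (hR : 0 < R₀) {r₀ δ ξ : ℝ} (hr : 0 < r₀)
    {n : ℕ} (hn : 0 < n) (hx : 0 < xn R₀ δ n ξ) (k : ℕ) :
    xnk Q r₀ R₀ δ n k ξ =
      tiltedIntegral (logPotential Q R₀) n k (-Real.log (xn R₀ δ n ξ / R₀)) /
        tiltedIntegral (logPotential Q R₀) n k (-Real.log (r₀ / R₀)) := by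
  have h : ∀ x, 0 < x → R₀ * Real.exp (-(-Real.log (x / R₀))) = x := by
    intro x hx
    rw [neg_neg, Real.exp_log (by positivity)]
    field_simp
  have h1 := integral_exp_neg_Vnk hQ hR hn k (-Real.log (xn R₀ δ n ξ / R₀))
  have h2 := integral_exp_neg_Vnk hQ hR hn k (-Real.log (r₀ / R₀))
  rw [h _ hx] at h1
  rw [h _ hr] at h2
  rw [xnk, h1, h2, mul_div_mul_left _ _ (Real.exp_pos _).ne']

end LogPotential

theorem tendsto_mul_neg_log_one_add {ι : Type*} {l : Filter ι} {N h : ι → ℝ} {c : ℝ}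
    (hN : Tendsto N l atTop) (hh : Tendsto (fun i => N i * h i) l (𝓝 c)) :
    Tendsto (fun i => N i * -Real.log (1 + h i)) l (𝓝 (-c)) := by
  have hNpos := hN.eventually_gt_atTop 0
  have hh0 : Tendsto h l (𝓝 0) := by
    refine (hh.div_atTop hN).congr' ?_
    filter_upwards [hNpos] with i hi
    field_simp
  have h1 : Tendsto (fun i => N i * h i / (1 + h i)) l (𝓝 c) := by
    have := hh.div (hh0.const_add 1) (by norm_num)
    rw [add_zero, div_one] at this
    exact this
  simp_rw [mul_neg]
  have hpos : ∀ᶠ i in l, -1 < h i := hh0.eventually_const_lt (by norm_num)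
  refine (tendsto_of_tendsto_of_tendsto_of_le_of_le' h1 hh ?_ ?_).neg
  · filter_upwards [hNpos, hpos] with i hi h0
    have h2 : 0 < 1 + h i := by linarith
    rw [mul_div_assoc]
    refine mul_le_mul_of_nonneg_left ?_ hi.le
    refine le_trans (le_of_eq ?_) (Real.one_sub_inv_le_log_of_pos h2)
    field_simp
    ring
  · filter_upwards [hNpos, hpos] with i hi h0
    refine mul_le_mul_of_nonneg_left ?_ hi.le
    linarith [Real.log_le_sub_one_of_pos (show 0 < 1 + h i by linarith)]

/-- Universality for the hard edge ensemble with radially symmetric potential: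
`∏_{k=0}^{n−1} (1 − x_{n,k}(ξ)) → e^ξ` uniformly for `ξ` in compact subsets of `(−∞, 0]`. -/
theorem hard_edge_radial_spectral_radius
    (Q : ℝ → ℝ) (r₀ R₀ δ : ℝ)
    (hQ : ContDiffOn ℝ 3 Q (Set.Ioi 0))
    (hsub : ∀ r > (0 : ℝ), 0 ≤ deriv (deriv Q) r + deriv Q r / r)
    (hstrict : ∃ ε > (0 : ℝ), ∀ r ∈ Set.Ioo (R₀ - ε) (R₀ + ε),
        0 < deriv (deriv Q) r + deriv Q r / r)
    (hr₀ : r₀ = sInf {t : ℝ | 0 < t ∧ ∀ r > t, 0 < deriv Q r})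
    (hR₀ : R₀ * deriv Q R₀ = 2)
    (hR₀min : ∀ R > (0 : ℝ), R * deriv Q R = 2 → R₀ ≤ R)
    (hr₀pos : 0 < r₀) (hr₀R₀ : r₀ < R₀)
    (hδ : δ = (1 / 4) * (deriv (deriv Q) R₀ + deriv Q R₀ / R₀)) (hδpos : 0 < δ)
    (K : Set ℝ) (hK : IsCompact K) (hK' : K ⊆ Set.Iic 0) :
    TendstoUniformlyOn
      (fun (n : ℕ) (ξ : ℝ) => ∏ k ∈ Finset.range n, (1 - xnk Q r₀ R₀ δ n k ξ))
      (fun ξ => Real.exp ξ) atTop K := by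
  have hR : 0 < R₀ := hr₀pos.trans hr₀R₀
  have hQd : ∀ r > 0, DifferentiableAt ℝ Q r := fun r hr =>
    (hQ.contDiffAt (Ioi_mem_nhds hr)).differentiableAt (by norm_num)
  have hQd' : ∀ r > 0, DifferentiableAt ℝ (deriv Q) r := fun r hr =>
    ((hQ.deriv_of_isOpen (m := 2) isOpen_Ioi (by norm_num)).contDiffAt
      (Ioi_mem_nhds hr)).differentiableAt (by norm_num)
  have hp : Continuous (logPotential Q R₀) := continuous_iff_continuousAt.2 fun t =>
    (hasDerivAt_logPotential hQd hR t).continuousAt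
  have hpos : ∀ t, 0 < t → t ≤ -Real.log (r₀ / R₀) → 0 < logPotential Q R₀ t := fun t ht _ =>
    logPotential_pos hQd hQd' hsub hR hR₀ hR₀min ht
  have hT : 0 < -Real.log (r₀ / R₀) :=
    neg_pos.2 (Real.log_neg (by positivity) ((div_lt_one hR).2 hr₀R₀))
  have hlim := tendsto_logPotential_div_sq hQd hQd' hR hR₀
  have hb : R₀ ^ 2 * (deriv (deriv Q) R₀ + deriv Q R₀ / R₀) / 2 = 2 * R₀ ^ 2 * δ := by
    rw [hδ]
    ring
  rw [hb] at hlim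
  have hlog2 : 0 < Real.log 2 := Real.log_pos one_lt_two
  have hlog4 : Real.log 4 = 2 * Real.log 2 := by
    rw [show (4 : ℝ) = 2 ^ 2 by norm_num, Real.log_pow]
    norm_num
  rw [← tendstoLocallyUniformlyOn_iff_tendstoUniformlyOn_of_compact hK,
    tendstoLocallyUniformlyOn_iff_forall_tendsto]
  intro ξ₀ _
  set l : Filter (ℕ × ℝ) := atTop ×ˢ 𝓝[K] ξ₀
  have hN : Tendsto (fun i : ℕ × ℝ => i.1) l atTop := tendsto_fst
  have hN' : Tendsto (fun i : ℕ × ℝ => (i.1 : ℝ)) l atTop := tendsto_natCast_atTop_atTop.comp hN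
  have hξ : Tendsto (fun i : ℕ × ℝ => i.2) l (𝓝 ξ₀) :=
    (tendsto_snd (f := atTop)).mono_right nhdsWithin_le_nhds
  have hξK : ∀ᶠ i : ℕ × ℝ in l, i.2 ≤ 0 :=
    (tendsto_snd (f := atTop)).eventually (eventually_mem_nhdsWithin.mono fun _ h => hK' h)
  have hNpos : ∀ᶠ i : ℕ × ℝ in l, 0 < i.1 := hN.eventually_gt_atTop 0
  set a : ℝ := R₀ ^ 2 * δ * Real.log 4 with ha
  have hapos : 0 < a := by
    rw [ha, hlog4]
    positivity
  set h : ℕ × ℝ → ℝ := fun i => i.2 / (i.1 * a) with hh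
  have hxn : ∀ i : ℕ × ℝ, xn R₀ δ i.1 i.2 / R₀ = 1 + h i := by
    intro i
    rw [xn, hh, ha]
    field_simp
  have hNh : Tendsto (fun i => (i.1 : ℝ) * h i) l (𝓝 (ξ₀ / a)) := by
    refine (hξ.div_const a).congr' (hNpos.mono fun i hi => ?_)
    rw [hh]
    field_simp
  have hw := tendsto_mul_neg_log_one_add hN' hNh
  have hh0 : Tendsto h l (𝓝 0) := by
    refine (hNh.div_atTop hN').congr' (hNpos.mono fun i hi => ?_)
    field_simp
  have hh1 : ∀ᶠ i in l, 0 < 1 + h i := by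
    filter_upwards [hh0.eventually_const_lt (show (-1 : ℝ) < 0 by norm_num)] with i hi
    linarith
  have hw0 : ∀ᶠ i in l, 0 ≤ -Real.log (1 + h i) := by
    filter_upwards [hξK, hh1] with i hi h1
    have : h i ≤ 0 := div_nonpos_of_nonpos_of_nonneg hi (by positivity)
    exact neg_nonneg.2 (Real.log_nonpos h1.le (by linarith))
  have hwT : ∀ᶠ i in l, -Real.log (1 + h i) ≤ -Real.log (r₀ / R₀) := by
    filter_upwards [hh0.eventually_const_lt
      (show r₀ / R₀ - 1 < 0 by linarith [(div_lt_one hR).2 hr₀R₀])] with i hi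
    exact neg_le_neg (Real.log_le_log (by positivity) (by linarith))
  have hbpos : 0 < 2 * R₀ ^ 2 * δ := by positivity
  have hp0 := logPotential_zero Q R₀
  have hsum := tendsto_sum_ratio hp hT hp0 hpos hbpos hlim hN hw0 hwT hw
  have hprod := tendsto_prod_one_sub (l := l) (N := fun i => i.1) (by
    filter_upwards [hw0, hwT] with i h0 h1 k _
    exact ⟨div_nonneg (tiltedIntegral_nonneg _ _ _ h0) (tiltedIntegral_nonneg _ _ _ hT.le),
      antitone_tiltedIntegral_div hp i.1 h0 hT h1 (Nat.cast_nonneg k)⟩)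
    (tendsto_ratio_zero hp hT hp0 hpos hbpos hlim hN hw0 hw) hsum
  have hS : -(-(ξ₀ / a) * (2 * R₀ ^ 2 * δ * Real.log 2)) = ξ₀ := by
    rw [ha, hlog4]
    field_simp
  rw [hS] at hprod
  have hF : Tendsto (fun i : ℕ × ℝ => ∏ k ∈ Finset.range i.1, (1 - xnk Q r₀ R₀ δ i.1 k i.2)) l
      (𝓝 (Real.exp ξ₀)) := by
    refine hprod.congr' ?_
    filter_upwards [hNpos, hh1] with i hi h1
    have hx : 0 < xn R₀ δ i.1 i.2 := by
      rw [← hxn, div_pos_iff_of_pos_right hR] at h1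
      exact h1
    refine Finset.prod_congr rfl fun k _ => ?_
    rw [xnk_eq hQd hR hr₀pos hi hx, hxn]
  exact (((Real.continuous_exp.tendsto ξ₀).comp hξ).prodMk_nhds hF).mono_right
    (nhds_le_uniformity (Real.exp ξ₀))
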